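/- Cut-elimination for NSMB: if a nested-sequent Γ ⇒ Δ, T is provable in NSMB, then there exists a proof of Γ ⇒ Δ, T in NSMB that does not use the rule (cut). -/

import Mathlib

set_option maxHeartbeats 1000000

namespace MBQL

/-- The fixed finite set `J ⊆ [0,1]` of inner-product values, with `0, 1 ∈ J`. -/
structure MBParams where
  J : Set ℝ
  finite : J.Finite
  subI : J ⊆ Set.Icc (0:ℝ) 1
  zero_mem : (0:ℝ) ∈ J
  one_mem : (1:ℝ) ∈ J

/-- Formulas of **MB**: `A ::= p | ⊤ | ⊥ | ¬A | A∧A | □^c_α A | □^o_α A` (α ∈ J). -/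
inductive MBForm (Pm : MBParams) : Type
  | var : ℕ → MBForm Pm
  | top : MBForm Pm
  | bot : MBForm Pm
  | neg : MBForm Pm → MBForm Pm
  | conj : MBForm Pm → MBForm Pm → MBForm Pm
  | boxc : Pm.J → MBForm Pm → MBForm Pm
  | boxo : Pm.J → MBForm Pm → MBForm Pm

noncomputable instance {Pm : MBParams} : DecidableEq (MBForm Pm) := Classical.decEq _

/-- Valuation of a formula, given worlds `S`, a relation `R : S → S → ℝ` and a
valuation `V` of the propositional variables. -/
def MBForm.valR {Pm : MBParams} {S : Type} (R : S → S → ℝ) (V : ℕ → Set S) :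
    MBForm Pm → Set S
  | .var n => V n
  | .top => Set.univ
  | .bot => ∅
  | .neg A => (A.valR R V)ᶜ
  | .conj A B => A.valR R V ∩ B.valR R V
  | .boxc α A => {s | ∀ t, (α : ℝ) ≤ R s t → t ∈ A.valR R V}
  | .boxo α A => {s | ∀ t, (α : ℝ) < R s t → t ∈ A.valR R V}

/-- An EQL-frame. -/
structure EQLFrame where
  S : Type
  nonempty : Nonempty S
  R : S → S → ℝ
  mem_Icc : ∀ s t, R s t ∈ Set.Icc (0:ℝ) 1
  eq_one_iff : ∀ s t, (R s t = 1 ↔ s = t)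
  symm : ∀ s t, R s t = R t s

/-- An MB-realization. -/
structure MBRealization (Pm : MBParams) where
  F : EQLFrame
  P : Set (Set F.S)
  univ_mem : Set.univ ∈ P
  empty_mem : ∅ ∈ P
  inter_mem : ∀ X ∈ P, ∀ Y ∈ P, X ∩ Y ∈ P
  compl_mem : ∀ X ∈ P, Xᶜ ∈ P
  boxc_mem : ∀ α ∈ Pm.J, ∀ X ∈ P, {s | ∀ t, α ≤ F.R s t → t ∈ X} ∈ P
  boxo_mem : ∀ α ∈ Pm.J, ∀ X ∈ P, {s | ∀ t, α < F.R s t → t ∈ X} ∈ P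
  V : ℕ → Set F.S
  V_mem : ∀ n, V n ∈ P

/-- The extended valuation of a formula in an MB-realization. -/
def MBRealization.val {Pm : MBParams} (M : MBRealization Pm) (A : MBForm Pm) :
    Set M.F.S := A.valR M.F.R M.V

/-- Validity of an MB-formula. -/
def MBValid {Pm : MBParams} (A : MBForm Pm) : Prop :=
  ∀ (M : MBRealization Pm) (s : M.F.S), s ∈ M.val A

inductive Side : Type
  | c : Side
  | o : Side
deriving DecidableEq

/-- A label `(α, d)` on a modal bracket, with `α ∈ J − {1}`. -/
structure MBLab (Pm : MBParams) where
  α : ℝ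
  memJ : α ∈ Pm.J
  ne_one : α ≠ 1
  d : Side

mutual
/-- Nested-sequents: a finite tree whose nodes are sequents (pairs of finite
sets of formulas) and whose edges carry labels. -/
inductive NSeq (Pm : MBParams) : Type
  | node : Finset (MBForm Pm) → Finset (MBForm Pm) → NSeqs Pm → NSeq Pm
/-- A finite list of labelled child nested-sequents. -/
inductive NSeqs (Pm : MBParams) : Type
  | nil : NSeqs Pm
  | cons : MBLab Pm → NSeq Pm → NSeqs Pm → NSeqs Pm
end

/-- The `i`-th labelled child. -/
def NSeqs.get {Pm : MBParams} : NSeqs Pm → ℕ → Option (MBLab Pm × NSeq Pm)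
  | .nil, _ => none
  | .cons l t _, 0 => some (l, t)
  | .cons _ _ ts, n+1 => ts.get n

/-- `SubAt t p u`: the subtree of `t` at the path (node address) `p` is `u`. -/
inductive SubAt {Pm : MBParams} : NSeq Pm → List ℕ → NSeq Pm → Prop
  | here (t : NSeq Pm) : SubAt t [] t
  | there {Γ Δ : Finset (MBForm Pm)} {ts : NSeqs Pm} {i : ℕ} {l : MBLab Pm}
      {u v : NSeq Pm} {p : List ℕ} :
      NSeqs.get ts i = some (l, u) → SubAt u p v → SubAt (.node Γ Δ ts) (i :: p) v

/-- `p` is (the address of) a node of `t`. -/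
def IsNode {Pm : MBParams} (t : NSeq Pm) (p : List ℕ) : Prop := ∃ u, SubAt t p u

mutual
/-- Replace the sequent at the node with address `p` by `Γ' ⇒ Δ'`
(children are kept). -/
def NSeq.setSeq {Pm : MBParams} :
    NSeq Pm → List ℕ → Finset (MBForm Pm) → Finset (MBForm Pm) → NSeq Pm
  | .node _ _ ts, [], Γ', Δ' => .node Γ' Δ' ts
  | .node Γ Δ ts, i :: p, Γ', Δ' => .node Γ Δ (NSeqs.setSeqs ts i p Γ' Δ')
def NSeqs.setSeqs {Pm : MBParams} :
    NSeqs Pm → ℕ → List ℕ → Finset (MBForm Pm) → Finset (MBForm Pm) → NSeqs Pm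
  | .nil, _, _, _, _ => .nil
  | .cons l t ts, 0, p, Γ', Δ' => .cons l (t.setSeq p Γ' Δ') ts
  | .cons l t ts, n+1, p, Γ', Δ' => .cons l t (NSeqs.setSeqs ts n p Γ' Δ')
end

/-- Append a labelled child at the end of a children list. -/
def NSeqs.snoc {Pm : MBParams} : NSeqs Pm → MBLab Pm → NSeq Pm → NSeqs Pm
  | .nil, l, u => .cons l u .nil
  | .cons l' t ts, l, u => .cons l' t (ts.snoc l u)

mutual
/-- Add a new child `[u]_l` at the node with address `p`. -/
def NSeq.addChild {Pm : MBParams} : NSeq Pm → List ℕ → MBLab Pm → NSeq Pm → NSeq Pm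
  | .node Γ Δ ts, [], l, u => .node Γ Δ (ts.snoc l u)
  | .node Γ Δ ts, i :: p, l, u => .node Γ Δ (NSeqs.addChilds ts i p l u)
def NSeqs.addChilds {Pm : MBParams} : NSeqs Pm → ℕ → List ℕ → MBLab Pm → NSeq Pm → NSeqs Pm
  | .nil, _, _, _, _ => .nil
  | .cons l' t ts, 0, p, l, u => .cons l' (t.addChild p l u) ts
  | .cons l' t ts, n+1, p, l, u => .cons l' t (NSeqs.addChilds ts n p l u)
end


/-- Logical connectives defined by abbreviation: `A ∨ B`. -/
def MBForm.or {Pm : MBParams} (A B : MBForm Pm) : MBForm Pm := .neg (.conj (.neg A) (.neg B))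

/-- `A → B := ¬A ∨ B`. -/
def MBForm.imp {Pm : MBParams} (A B : MBForm Pm) : MBForm Pm := (MBForm.neg A).or B

/-- Conjunction of a list of formulas. -/
def conjList {Pm : MBParams} : List (MBForm Pm) → MBForm Pm
  | [] => .top
  | [A] => A
  | A :: B :: rest => .conj A (conjList (B :: rest))

/-- Disjunction of a list of formulas. -/
def disjList {Pm : MBParams} : List (MBForm Pm) → MBForm Pm
  | [] => .bot
  | [A] => A
  | A :: B :: rest => (A).or (disjList (B :: rest))

/-- `⋀Γ → ⋁Δ`. -/
noncomputable def seqForm {Pm : MBParams} (Γ Δ : Finset (MBForm Pm)) : MBForm Pm :=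
  (conjList Γ.toList).imp (disjList Δ.toList)

/-- The box corresponding to a bracket label. -/
def MBLab.box {Pm : MBParams} (l : MBLab Pm) (A : MBForm Pm) : MBForm Pm :=
  match l.d with
  | .c => .boxc ⟨l.α, l.memJ⟩ A
  | .o => .boxo ⟨l.α, l.memJ⟩ A

mutual
/-- The interpretation `τ` of a nested-sequent as a formula. -/
noncomputable def NSeq.tau {Pm : MBParams} : NSeq Pm → MBForm Pm
  | .node Γ Δ ts => NSeqs.tauAux (seqForm Γ Δ) ts
noncomputable def NSeqs.tauAux {Pm : MBParams} : MBForm Pm → NSeqs Pm → MBForm Pm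
  | A, .nil => A
  | A, .cons l t ts => NSeqs.tauAux (A.or (l.box t.tau)) ts
end

/-- `E` is an embedding of the nested-sequent `t` into the realization `M`
(`E` is given on node addresses). -/
def IsEmb {Pm : MBParams} (M : MBRealization Pm) (t : NSeq Pm)
    (E : List ℕ → M.F.S) : Prop :=
  ∀ p Γ Δ ts i l u, SubAt t p (.node Γ Δ ts) → NSeqs.get ts i = some (l, u) →
    (l.d = Side.c → l.α ≤ M.F.R (E p) (E (p ++ [i]))) ∧
    (l.d = Side.o → l.α < M.F.R (E p) (E (p ++ [i])))

/-- The nested-sequent `t` is false in `M` under `E`. -/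
def FalseUnder {Pm : MBParams} (M : MBRealization Pm) (t : NSeq Pm)
    (E : List ℕ → M.F.S) : Prop :=
  ∀ p Γ Δ ts, SubAt t p (.node Γ Δ ts) →
    (∀ A ∈ Γ, E p ∈ M.val A) ∧ (∀ A ∈ Δ, E p ∉ M.val A)

/-- Validity of a nested-sequent: it is not false under any embedding into
any MB-realization. -/
def NSValid {Pm : MBParams} (t : NSeq Pm) : Prop :=
  ∀ (M : MBRealization Pm) (E : List ℕ → M.F.S), IsEmb M t E → ¬ FalseUnder M t E


/-- `□^d_α A`. -/
def mkBox {Pm : MBParams} (d : Side) (α : Pm.J) (A : MBForm Pm) : MBForm Pm :=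
  match d with
  | .c => .boxc α A
  | .o => .boxo α A

/-- The total order `⪯` on `I × {c,o}`: `pleq α d β d'` means `(α,d) ⪯ (β,d')`. -/
def pleq : ℝ → Side → ℝ → Side → Prop
  | α, .o, β, .c => α < β
  | α, _, β, _ => α ≤ β

/-- Provability in the nested-sequent calculus **NSMB**.  The boolean
parameter records whether the rule (cut) may be used. -/
inductive Provable {Pm : MBParams} : Bool → NSeq Pm → Prop
  /-- axiom `‖A, Γ ⇒ Δ, A, T‖` -/
  | axId {cut : Bool} {t : NSeq Pm} {p Γ Δ ts A} :
      SubAt t p (.node Γ Δ ts) → A ∈ Γ → A ∈ Δ → Provable cut t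
  /-- axiom `‖Γ ⇒ Δ, ⊤, T‖` -/
  | axTop {cut : Bool} {t : NSeq Pm} {p Γ Δ ts} :
      SubAt t p (.node Γ Δ ts) → MBForm.top ∈ Δ → Provable cut t
  /-- axiom `‖⊥, Γ ⇒ Δ, T‖` -/
  | axBot {cut : Bool} {t : NSeq Pm} {p Γ Δ ts} :
      SubAt t p (.node Γ Δ ts) → MBForm.bot ∈ Γ → Provable cut t
  /-- axiom `‖Γ ⇒ Δ, □^o_1 A, T‖` -/
  | axBoxO1 {cut : Bool} {t : NSeq Pm} {p Γ Δ ts A} :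
      SubAt t p (.node Γ Δ ts) → MBForm.boxo ⟨1, Pm.one_mem⟩ A ∈ Δ → Provable cut t
  /-- rule (cut) -/
  | cutR {t : NSeq Pm} {p Γ Δ ts A} :
      SubAt t p (.node Γ Δ ts) →
      Provable true (t.setSeq p Γ (insert A Δ)) →
      Provable true (t.setSeq p (insert A Γ) Δ) →
      Provable true t
  /-- rule (wL) -/
  | wL {cut : Bool} {t : NSeq Pm} {p Γ Δ ts A} :
      SubAt t p (.node Γ Δ ts) → Provable cut t →
      Provable cut (t.setSeq p (insert A Γ) Δ)
  /-- rule (wR) -/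
  | wR {cut : Bool} {t : NSeq Pm} {p Γ Δ ts A} :
      SubAt t p (.node Γ Δ ts) → Provable cut t →
      Provable cut (t.setSeq p Γ (insert A Δ))
  /-- rule (¬L) -/
  | negL {cut : Bool} {t : NSeq Pm} {p Γ Δ ts A} :
      SubAt t p (.node Γ Δ ts) →
      Provable cut (t.setSeq p Γ (insert A Δ)) →
      Provable cut (t.setSeq p (insert (MBForm.neg A) Γ) Δ)
  /-- rule (¬R) -/
  | negR {cut : Bool} {t : NSeq Pm} {p Γ Δ ts A} :
      SubAt t p (.node Γ Δ ts) →
      Provable cut (t.setSeq p (insert A Γ) Δ) →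
      Provable cut (t.setSeq p Γ (insert (MBForm.neg A) Δ))
  /-- rule (∧L) -/
  | andL {cut : Bool} {t : NSeq Pm} {p Γ Δ ts A B} :
      SubAt t p (.node Γ Δ ts) →
      Provable cut (t.setSeq p (insert A (insert B Γ)) Δ) →
      Provable cut (t.setSeq p (insert (MBForm.conj A B) Γ) Δ)
  /-- rule (∧R) -/
  | andR {cut : Bool} {t : NSeq Pm} {p Γ Δ ts A B} :
      SubAt t p (.node Γ Δ ts) →
      Provable cut (t.setSeq p Γ (insert A Δ)) →
      Provable cut (t.setSeq p Γ (insert B Δ)) →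
      Provable cut (t.setSeq p Γ (insert (MBForm.conj A B) Δ))
  /-- rule (□L), with side condition `(α,d) ⪯ (β,d')` -/
  | boxL {cut : Bool} {t : NSeq Pm} {p Γ Δ ts i l u Γ' Δ' ts' A} {α : Pm.J} {d : Side} :
      SubAt t p (.node Γ Δ ts) → NSeqs.get ts i = some (l, u) →
      SubAt t (p ++ [i]) (.node Γ' Δ' ts') →
      pleq (α : ℝ) d l.α l.d →
      Provable cut (t.setSeq (p ++ [i]) (insert A Γ') Δ') →
      Provable cut (t.setSeq p (insert (mkBox d α A) Γ) Δ)
  /-- rule (□L sym), with side condition `(α,d) ⪯ (β,d')` -/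
  | boxLsym {cut : Bool} {t : NSeq Pm} {p Γ Δ ts i l u Γ' Δ' ts' A} {α : Pm.J} {d : Side} :
      SubAt t p (.node Γ Δ ts) → NSeqs.get ts i = some (l, u) →
      SubAt t (p ++ [i]) (.node Γ' Δ' ts') →
      pleq (α : ℝ) d l.α l.d →
      Provable cut (t.setSeq p (insert A Γ) Δ) →
      Provable cut (t.setSeq (p ++ [i]) (insert (mkBox d α A) Γ') Δ')
  /-- rule (□L self), with side condition `(α,d) ≠ (1,o)` -/
  | boxLself {cut : Bool} {t : NSeq Pm} {p Γ Δ ts A} {α : Pm.J} {d : Side} :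
      SubAt t p (.node Γ Δ ts) → ¬((α : ℝ) = 1 ∧ d = Side.o) →
      Provable cut (t.setSeq p (insert A Γ) Δ) →
      Provable cut (t.setSeq p (insert (mkBox d α A) Γ) Δ)
  /-- rule (□^c_0): erase `A` from the left of one node and add `□^c_0 A`
  to the left of another arbitrary node -/
  | boxC0 {cut : Bool} {t : NSeq Pm} {p Γ Δ ts q Γ'' Δ'' ts'' A} :
      SubAt t p (.node Γ Δ ts) → SubAt t q (.node Γ'' Δ'' ts'') →
      Provable cut (t.setSeq p (insert A Γ) Δ) →
      Provable cut (t.setSeq q (insert (MBForm.boxc ⟨0, Pm.zero_mem⟩ A) Γ'') Δ'')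
  /-- rule (□R) -/
  | boxR {cut : Bool} {t : NSeq Pm} {p Γ Δ ts A} {l : MBLab Pm} :
      SubAt t p (.node Γ Δ ts) →
      Provable cut (t.addChild p l (.node ∅ {A} .nil)) →
      Provable cut (t.setSeq p Γ (insert (l.box A) Δ))
  /-- rule (□R self) -/
  | boxRself {cut : Bool} {t : NSeq Pm} {p Γ Δ ts A} :
      SubAt t p (.node Γ Δ ts) →
      Provable cut (t.setSeq p Γ (insert A Δ)) →
      Provable cut (t.setSeq p Γ (insert (MBForm.boxc ⟨1, Pm.one_mem⟩ A) Δ))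


/-- The subformula relation. -/
inductive Subf {Pm : MBParams} : MBForm Pm → MBForm Pm → Prop
  | refl (A : MBForm Pm) : Subf A A
  | negS {A B : MBForm Pm} : Subf A B → Subf A (.neg B)
  | conjL {A B C : MBForm Pm} : Subf A B → Subf A (.conj B C)
  | conjR {A B C : MBForm Pm} : Subf A C → Subf A (.conj B C)
  | boxcS {A B : MBForm Pm} {α : Pm.J} : Subf A B → Subf A (.boxc α B)
  | boxoS {A B : MBForm Pm} {α : Pm.J} : Subf A B → Subf A (.boxo α B)

/-- `A` occurs in (some sequent of) the nested-sequent `t`. -/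
def OccursIn {Pm : MBParams} (A : MBForm Pm) (t : NSeq Pm) : Prop :=
  ∃ p Γ Δ ts, SubAt t p (.node Γ Δ ts) ∧ (A ∈ Γ ∨ A ∈ Δ)

/-- One step of the saturation procedure used to build `Γ_C ⇒ Δ_C, T_C`.
The state is a nested-sequent together with the set of (address, formula)
occurrences of right-hand boxed formulas that have already been processed by
step (8). -/
inductive SatStep {Pm : MBParams} :
    NSeq Pm × Set (List ℕ × MBForm Pm) → NSeq Pm × Set (List ℕ × MBForm Pm) → Prop
  /-- step (1): `A ∧ B` on the left -/
  | andL {t D p Γ Δ ts A B} :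
      SubAt t p (.node Γ Δ ts) → MBForm.conj A B ∈ Γ →
      SatStep (t, D) (t.setSeq p (insert A (insert B Γ)) Δ, D)
  /-- step (2): `A ∧ B` on the right; the disjunct keeping unprovability is adopted -/
  | andR {t D p Γ Δ ts A B C} :
      SubAt t p (.node Γ Δ ts) → MBForm.conj A B ∈ Δ → (C = A ∨ C = B) →
      ¬ Provable true (t.setSeq p Γ (insert C Δ)) →
      SatStep (t, D) (t.setSeq p Γ (insert C Δ), D)
  /-- step (3): `¬A` on the left -/
  | negL {t D p Γ Δ ts A} :
      SubAt t p (.node Γ Δ ts) → MBForm.neg A ∈ Γ →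
      SatStep (t, D) (t.setSeq p Γ (insert A Δ), D)
  /-- step (4): `¬A` on the right -/
  | negR {t D p Γ Δ ts A} :
      SubAt t p (.node Γ Δ ts) → MBForm.neg A ∈ Δ →
      SatStep (t, D) (t.setSeq p (insert A Γ) Δ, D)
  /-- step (5): `□^d_α A` on the left of the parent of a bracket with `(α,d) ⪯ (β,d')` -/
  | boxL {t D p Γ Δ ts i l u Γ' Δ' ts' A} {α : Pm.J} {d : Side} :
      SubAt t p (.node Γ Δ ts) → NSeqs.get ts i = some (l, u) →
      SubAt t (p ++ [i]) (.node Γ' Δ' ts') →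
      pleq (α : ℝ) d l.α l.d → mkBox d α A ∈ Γ →
      SatStep (t, D) (t.setSeq (p ++ [i]) (insert A Γ') Δ', D)
  /-- step (6): `□^d_α A` on the left of the child of a bracket with `(α,d) ⪯ (β,d')` -/
  | boxLsym {t D p Γ Δ ts i l u Γ' Δ' ts' A} {α : Pm.J} {d : Side} :
      SubAt t p (.node Γ Δ ts) → NSeqs.get ts i = some (l, u) →
      SubAt t (p ++ [i]) (.node Γ' Δ' ts') →
      pleq (α : ℝ) d l.α l.d → mkBox d α A ∈ Γ' →
      SatStep (t, D) (t.setSeq p (insert A Γ) Δ, D)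
  /-- step (7): `□^d_α A` on the left, `(α,d) ≠ (1,o)` -/
  | boxLself {t D p Γ Δ ts A} {α : Pm.J} {d : Side} :
      SubAt t p (.node Γ Δ ts) → ¬((α : ℝ) = 1 ∧ d = Side.o) → mkBox d α A ∈ Γ →
      SatStep (t, D) (t.setSeq p (insert A Γ) Δ, D)
  /-- step (8): `□^d_α A` on the right (`α ≠ 1`), performed once per occurrence -/
  | boxR {t D p Γ Δ ts A} {α : Pm.J} {d : Side} (hne : (α : ℝ) ≠ 1) :
      SubAt t p (.node Γ Δ ts) → mkBox d α A ∈ Δ → (p, mkBox d α A) ∉ D →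
      SatStep (t, D)
        (t.addChild p ⟨(α : ℝ), α.2, hne, d⟩ (.node ∅ {A} .nil),
         insert (p, mkBox d α A) D)
  /-- step (9): `□^c_1 A` on the right -/
  | boxRself {t D p Γ Δ ts A} :
      SubAt t p (.node Γ Δ ts) → MBForm.boxc ⟨1, Pm.one_mem⟩ A ∈ Δ →
      SatStep (t, D) (t.setSeq p Γ (insert A Δ), D)
  /-- step (10): `□^c_0 A` on the left of some node: add `A` to the left of any node -/
  | boxC0 {t D p Γ Δ ts q Γ'' Δ'' ts'' A} :
      SubAt t p (.node Γ Δ ts) → MBForm.boxc ⟨0, Pm.zero_mem⟩ A ∈ Γ →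
      SubAt t q (.node Γ'' Δ'' ts'') →
      SatStep (t, D) (t.setSeq q (insert A Γ'') Δ'', D)

/-- A state of the saturation procedure is saturated (terminal) when no
saturation step changes it any more. -/
def Saturated {Pm : MBParams} (s : NSeq Pm × Set (List ℕ × MBForm Pm)) : Prop :=
  ∀ s', SatStep s s' → s' = s


mutual
/-- The subtree of `t` at address `p`, as a function. -/
def NSeq.sub? {Pm : MBParams} : NSeq Pm → List ℕ → Option (NSeq Pm)
  | t, [] => some t
  | .node _ _ ts, i :: p => NSeqs.subs? ts i p
def NSeqs.subs? {Pm : MBParams} : NSeqs Pm → ℕ → List ℕ → Option (NSeq Pm)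
  | .nil, _, _ => none
  | .cons _ t _, 0, p => t.sub? p
  | .cons _ _ ts, n+1, p => NSeqs.subs? ts n p
end

/-- The label of the edge from the node at address `p` to its `i`-th child. -/
def labelAt {Pm : MBParams} (t : NSeq Pm) (p : List ℕ) (i : ℕ) : Option (MBLab Pm) :=
  match t.sub? p with
  | some (.node _ _ ts) => (NSeqs.get ts i).map Prod.fst
  | none => none

/-- The set of elements of `J` appearing in a formula. -/
def MBForm.jsetF {Pm : MBParams} : MBForm Pm → Set ℝ
  | .var _ => ∅
  | .top => ∅
  | .bot => ∅
  | .neg A => A.jsetF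
  | .conj A B => A.jsetF ∪ B.jsetF
  | .boxc α A => insert (α : ℝ) A.jsetF
  | .boxo α A => insert (α : ℝ) A.jsetF

mutual
/-- The numbers appearing in a nested-sequent (in formulas or brackets). -/
def NSeq.jsetT {Pm : MBParams} : NSeq Pm → Set ℝ
  | .node Γ Δ ts =>
      (⋃ A ∈ Γ, MBForm.jsetF A) ∪ (⋃ A ∈ Δ, MBForm.jsetF A) ∪ NSeqs.jsetTs ts
def NSeqs.jsetTs {Pm : MBParams} : NSeqs Pm → Set ℝ
  | .nil => ∅
  | .cons l t ts => insert l.α (t.jsetT ∪ NSeqs.jsetTs ts)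
end

/-- `(Γ ⇒ Δ, T)_J`: the numbers appearing in the nested-sequent, with `0` and `1`. -/
def jset {Pm : MBParams} (t : NSeq Pm) : Set ℝ :=
  insert (0:ℝ) (insert (1:ℝ) t.jsetT)

/-- `U` is an interpolated set of `Js`. -/
def Interpolated (Js U : Set ℝ) : Prop :=
  U.Finite ∧ U ⊆ Set.Icc (0:ℝ) 1 ∧ Js ⊆ U ∧
    ∀ α ∈ Js, ∀ β ∈ Js, α < β → (∀ γ ∈ Js, ¬ (α < γ ∧ γ < β)) →
      ∃! δ, δ ∈ U ∧ α < δ ∧ δ < β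

/-- `Suc U α`: the successor of `α` in the interpolated set `U` (with `Suc 1 = 1`). -/
noncomputable def Suc (U : Set ℝ) (α : ℝ) : ℝ := sInf ((U ∩ Set.Ioi α) ∪ {1})

/-- Auxiliary value of the canonical relation in case `q` is the child of `p`
via a bracket (`β` for `[·]^c_β`, `Suc β` for `[·]^o_β`), and `0` otherwise. -/
noncomputable def lval {Pm : MBParams} (t : NSeq Pm) (U : Set ℝ) (p q : List ℕ) : ℝ :=
  match q.getLast? with
  | none => 0
  | some i =>
      if q.dropLast = p then
        match labelAt t p i with
        | some l => (match l.d with | Side.c => l.α | Side.o => Suc U l.α)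
        | none => 0
      else 0

/-- The canonical relation `R_C` (on node addresses). -/
noncomputable def RC {Pm : MBParams} (t : NSeq Pm) (U : Set ℝ) (p q : List ℕ) : ℝ :=
  if p = q then 1 else max (lval t U p q) (lval t U q p)

/-- The worlds of the canonical model: the nodes of the saturated nested-sequent. -/
def World {Pm : MBParams} (t : NSeq Pm) : Type := {p : List ℕ // IsNode t p}

/-- The canonical relation `R_C`, as a function on the worlds. -/
noncomputable def RCW {Pm : MBParams} (t : NSeq Pm) (U : Set ℝ) (p q : World t) : ℝ :=
  RC t U p.val q.val

/-- The canonical valuation `V_C` of the propositional variables. -/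
def VC {Pm : MBParams} (t : NSeq Pm) (n : ℕ) : Set (World t) :=
  {p | ∃ Γ Δ ts, SubAt t p.val (.node Γ Δ ts) ∧ MBForm.var n ∈ Γ}

/-- `P_C`: the family of all definable sets of worlds of the canonical model. -/
def PC {Pm : MBParams} (t : NSeq Pm) (U : Set ℝ) : Set (Set (World t)) :=
  {X | ∃ A : MBForm Pm, X = MBForm.valR (RCW t U) (VC t) A}


/-! ### Node access by functions -/

def sAt {Pm : MBParams} : List ℕ → NSeq Pm → Option (Finset (MBForm Pm) × Finset (MBForm Pm))
  | [], .node Γ Δ _ => some (Γ, Δ)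
  | i :: p, .node _ _ ts => (NSeqs.get ts i).bind (fun x => sAt p x.2)

def lAt {Pm : MBParams} : List ℕ → ℕ → NSeq Pm → Option (MBLab Pm)
  | [], i, .node _ _ ts => (NSeqs.get ts i).map Prod.fst
  | j :: p, i, .node _ _ ts => (NSeqs.get ts j).bind (fun x => lAt p i x.2)

def nlen {Pm : MBParams} : NSeqs Pm → ℕ
  | .nil => 0
  | .cons _ _ ts => nlen ts + 1

theorem SubAt.sAt {Pm : MBParams} {t v : NSeq Pm} {p : List ℕ} (h : SubAt t p v) :
    ∀ {Γ Δ ts}, v = .node Γ Δ ts → sAt p t = some (Γ, Δ) := by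
  induction h with
  | here t => rintro Γ Δ ts rfl; rfl
  | there hg _ ih => intro Γ Δ ts e; simp [MBQL.sAt, hg, ih e]

theorem SubAt.lAt {Pm : MBParams} {t v : NSeq Pm} {p : List ℕ} (h : SubAt t p v) :
    ∀ {Γ Δ ts}, v = .node Γ Δ ts → ∀ i, lAt p i t = (NSeqs.get ts i).map Prod.fst := by
  induction h with
  | here t => rintro Γ Δ ts rfl i; rfl
  | there hg _ ih => intro Γ Δ ts e i; simp [MBQL.lAt, hg, ih e]

theorem subAt_of_sAt {Pm : MBParams} : ∀ (p : List ℕ) (t : NSeq Pm) {Γ Δ},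
    sAt p t = some (Γ, Δ) → ∃ ts, SubAt t p (.node Γ Δ ts)
  | [], .node Γ Δ ts, Γ', Δ', h => by
      simp only [sAt, Option.some.injEq, Prod.mk.injEq] at h
      obtain ⟨rfl, rfl⟩ := h
      exact ⟨ts, .here _⟩
  | i :: p, .node Γ Δ ts, Γ', Δ', h => by
      simp only [sAt, Option.bind_eq_some_iff] at h
      obtain ⟨⟨l, u⟩, hg, h⟩ := h
      obtain ⟨ts', h'⟩ := subAt_of_sAt p u h
      exact ⟨ts', .there hg h'⟩

theorem get_setSeqs {Pm : MBParams} : ∀ (ts : NSeqs Pm) (i j : ℕ) (p Γ Δ),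
    NSeqs.get (NSeqs.setSeqs ts i p Γ Δ) j =
      if j = i then (NSeqs.get ts i).map (fun x => (x.1, x.2.setSeq p Γ Δ)) else NSeqs.get ts j
  | .nil, i, j, p, Γ, Δ => by simp [NSeqs.setSeqs, NSeqs.get]
  | .cons l t ts, 0, 0, p, Γ, Δ => by simp [NSeqs.setSeqs, NSeqs.get]
  | .cons l t ts, 0, j+1, p, Γ, Δ => by simp [NSeqs.setSeqs, NSeqs.get]
  | .cons l t ts, i+1, 0, p, Γ, Δ => by simp [NSeqs.setSeqs, NSeqs.get]
  | .cons l t ts, i+1, j+1, p, Γ, Δ => by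
      simp [NSeqs.setSeqs, NSeqs.get, get_setSeqs ts i j p Γ Δ]

theorem get_addChilds {Pm : MBParams} : ∀ (ts : NSeqs Pm) (i j : ℕ) (p l u),
    NSeqs.get (NSeqs.addChilds ts i p l u) j =
      if j = i then (NSeqs.get ts i).map (fun x => (x.1, x.2.addChild p l u)) else NSeqs.get ts j
  | .nil, i, j, p, Γ, Δ => by simp [NSeqs.addChilds, NSeqs.get]
  | .cons l t ts, 0, 0, p, Γ, Δ => by simp [NSeqs.addChilds, NSeqs.get]
  | .cons l t ts, 0, j+1, p, Γ, Δ => by simp [NSeqs.addChilds, NSeqs.get]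
  | .cons l t ts, i+1, 0, p, Γ, Δ => by simp [NSeqs.addChilds, NSeqs.get]
  | .cons l t ts, i+1, j+1, p, Γ, Δ => by
      simp [NSeqs.addChilds, NSeqs.get, get_addChilds ts i j p Γ Δ]

theorem get_snoc {Pm : MBParams} : ∀ (ts : NSeqs Pm) (j : ℕ) (l u),
    NSeqs.get (NSeqs.snoc ts l u) j =
      if j = nlen ts then some (l, u) else NSeqs.get ts j
  | .nil, 0, l, u => by simp [NSeqs.snoc, NSeqs.get, nlen]
  | .nil, j+1, l, u => by simp [NSeqs.snoc, NSeqs.get, nlen]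
  | .cons l' t ts, 0, l, u => by simp [NSeqs.snoc, NSeqs.get, nlen]
  | .cons l' t ts, j+1, l, u => by simp [NSeqs.snoc, NSeqs.get, nlen, get_snoc ts j l u]

theorem get_nlen {Pm : MBParams} : ∀ (ts : NSeqs Pm), NSeqs.get ts (nlen ts) = none
  | .nil => rfl
  | .cons _ _ ts => by simpa [NSeqs.get, nlen] using get_nlen ts

theorem sAt_setSeq {Pm : MBParams} : ∀ (p q : List ℕ) (t : NSeq Pm) (Γ Δ),
    sAt q (t.setSeq p Γ Δ) = if q = p then (sAt p t).map (fun _ => (Γ, Δ)) else sAt q t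
  | [], [], .node _ _ _, Γ, Δ => by simp [NSeq.setSeq, sAt]
  | [], j :: q, .node _ _ _, Γ, Δ => by simp [NSeq.setSeq, sAt]
  | i :: p, [], .node _ _ _, Γ, Δ => by simp [NSeq.setSeq, sAt]
  | i :: p, j :: q, .node _ _ ts, Γ, Δ => by
      simp only [NSeq.setSeq, sAt, get_setSeqs]
      by_cases hj : j = i
      · subst hj
        cases hg : NSeqs.get ts j with
        | none => simp
        | some x => simp [sAt_setSeq p q x.2 Γ Δ]
      · simp [hj]

theorem lAt_setSeq {Pm : MBParams} : ∀ (p q : List ℕ) (k : ℕ) (t : NSeq Pm) (Γ Δ),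
    lAt q k (t.setSeq p Γ Δ) = lAt q k t
  | [], [], k, .node _ _ _, Γ, Δ => by simp [NSeq.setSeq, lAt]
  | [], j :: q, k, .node _ _ _, Γ, Δ => by simp [NSeq.setSeq, lAt]
  | i :: p, [], k, .node _ _ ts, Γ, Δ => by
      simp only [NSeq.setSeq, lAt, get_setSeqs]
      by_cases hj : k = i
      · subst hj
        cases hg : NSeqs.get ts k <;> simp
      · simp [hj]
  | i :: p, j :: q, k, .node _ _ ts, Γ, Δ => by
      simp only [NSeq.setSeq, lAt, get_setSeqs]
      by_cases hj : j = i
      · subst hj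
        cases hg : NSeqs.get ts j with
        | none => simp
        | some x => simp [lAt_setSeq p q k x.2 Γ Δ]
      · simp [hj]

theorem setSeq_self_aux {Pm : MBParams} : ∀ (ts : NSeqs Pm) (i : ℕ) (p Γ Δ) (l u),
    NSeqs.get ts i = some (l, u) → u.setSeq p Γ Δ = u → NSeqs.setSeqs ts i p Γ Δ = ts
  | .nil, i, p, Γ, Δ, l, u, h, _ => by simp [NSeqs.get] at h
  | .cons l t ts, 0, p, Γ, Δ, l', u, h, hu => by
      simp only [NSeqs.get, Option.some.injEq, Prod.mk.injEq] at h
      obtain ⟨rfl, rfl⟩ := h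
      simp [NSeqs.setSeqs, hu]
  | .cons l t ts, i+1, p, Γ, Δ, l', u, h, hu => by
      simp only [NSeqs.get] at h
      simp [NSeqs.setSeqs, setSeq_self_aux ts i p Γ Δ l' u h hu]

theorem SubAt.setSeq_self {Pm : MBParams} {t v : NSeq Pm} {p : List ℕ} (h : SubAt t p v) :
    ∀ {Γ Δ ts}, v = .node Γ Δ ts → t.setSeq p Γ Δ = t := by
  induction h with
  | here t => rintro Γ Δ ts rfl; rfl
  | there hg _ ih =>
      intro Γ Δ ts e
      simp [NSeq.setSeq, setSeq_self_aux _ _ _ _ _ _ _ hg (ih e)]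

theorem SubAt.sAt_addChild {Pm : MBParams} {t v : NSeq Pm} {p : List ℕ} (h : SubAt t p v)
    (l : MBLab Pm) (Γ' Δ' : Finset (MBForm Pm)) :
    ∀ {Γ Δ ts}, v = .node Γ Δ ts → ∀ q, MBQL.sAt q (t.addChild p l (.node Γ' Δ' .nil)) =
      if q = p ++ [nlen ts] then some (Γ', Δ') else MBQL.sAt q t := by
  induction h with
  | here t =>
      rintro Γ Δ ts rfl q
      cases q with
      | nil => simp [NSeq.addChild, MBQL.sAt]
      | cons j q =>
        simp only [NSeq.addChild, MBQL.sAt, get_snoc]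
        by_cases hj : j = nlen ts
        · subst hj
          cases q with
          | nil => simp [MBQL.sAt]
          | cons k q => simp [MBQL.sAt, get_nlen, NSeqs.get]
        · simp [hj]
  | @there Γ0 Δ0 ts0 i l' u v p hg _ ih =>
      intro Γ Δ ts e q
      cases q with
      | nil => simp [NSeq.addChild, MBQL.sAt]
      | cons j q =>
        simp only [NSeq.addChild, MBQL.sAt, get_addChilds]
        by_cases hj : j = i
        · subst hj
          simp [hg, ih e]
        · simp [hj]

theorem SubAt.lAt_addChild {Pm : MBParams} {t v : NSeq Pm} {p : List ℕ} (h : SubAt t p v)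
    (l : MBLab Pm) (Γ' Δ' : Finset (MBForm Pm)) :
    ∀ {Γ Δ ts}, v = .node Γ Δ ts → ∀ q k, MBQL.lAt q k (t.addChild p l (.node Γ' Δ' .nil)) =
      if q = p ∧ k = nlen ts then some l else MBQL.lAt q k t := by
  induction h with
  | here t =>
      rintro Γ Δ ts rfl q k
      cases q with
      | nil =>
        simp only [NSeq.addChild, MBQL.lAt, get_snoc]
        by_cases hj : k = nlen ts <;> simp [hj]
      | cons j q =>
        simp only [NSeq.addChild, MBQL.lAt, get_snoc]
        by_cases hj : j = nlen ts
        · subst hj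
          cases q with
          | nil => simp [MBQL.lAt, get_nlen, NSeqs.get]
          | cons k q => simp [MBQL.lAt, get_nlen, NSeqs.get]
        · simp [hj]
  | @there Γ0 Δ0 ts0 i l' u v p hg _ ih =>
      intro Γ Δ ts e q k
      cases q with
      | nil =>
        simp only [NSeq.addChild, MBQL.lAt, get_addChilds]
        by_cases hj : k = i
        · subst hj
          simp [hg]
        · simp [hj]
      | cons j q =>
        simp only [NSeq.addChild, MBQL.lAt, get_addChilds]
        by_cases hj : j = i
        · subst hj
          simp [hg, ih e]
        · simp [hj]

theorem sAt_of_lAt {Pm : MBParams} : ∀ (p : List ℕ) (i : ℕ) (t : NSeq Pm) (l : MBLab Pm),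
    lAt p i t = some l → (∃ x, sAt p t = some x) ∧ (∃ x, sAt (p ++ [i]) t = some x)
  | [], i, .node Γ Δ ts, l, h => by
      simp only [lAt, Option.map_eq_some_iff] at h
      obtain ⟨⟨l', ⟨Γ', Δ', ts'⟩⟩, hg, _⟩ := h
      exact ⟨⟨_, rfl⟩, (Γ', Δ'), by simp [sAt, hg]⟩
  | j :: p, i, .node Γ Δ ts, l, h => by
      simp only [lAt, Option.bind_eq_some_iff] at h
      obtain ⟨⟨l', u⟩, hg, h⟩ := h
      simpa [sAt, hg] using sAt_of_lAt p i u l h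

theorem sAt_none {Pm : MBParams} : ∀ (p : List ℕ) (i : ℕ) (t : NSeq Pm),
    lAt p i t = none → sAt (p ++ [i]) t = none
  | [], i, .node Γ Δ ts, h => by
      simp only [lAt, Option.map_eq_none_iff] at h
      simp [sAt, h]
  | j :: p, i, .node Γ Δ ts, h => by
      simp only [lAt] at h
      simp only [List.cons_append, sAt]
      cases hg : NSeqs.get ts j with
      | none => rfl
      | some x =>
        rw [hg] at h
        exact sAt_none p i x.2 h

/-! ### Soundness -/

def relS : Side → ℝ → ℝ → Prop
  | .c, α, r => α ≤ r
  | .o, α, r => α < r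

theorem relS_of_pleq {α β r : ℝ} {d d' : Side} (h : pleq α d β d') (h' : relS d' β r) :
    relS d α r := by
  cases d <;> cases d' <;> simp only [pleq, relS] at * <;> linarith

theorem mem_mkBox {Pm : MBParams} {S : Type} {R : S → S → ℝ} {V : ℕ → Set S} {d : Side}
    {α : Pm.J} {A : MBForm Pm} {s : S} :
    s ∈ (mkBox d α A).valR R V ↔ ∀ t, relS d α (R s t) → t ∈ A.valR R V := by
  cases d <;> simp [mkBox, MBForm.valR, relS]

theorem box_eq {Pm : MBParams} (l : MBLab Pm) (A : MBForm Pm) :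
    l.box A = mkBox l.d ⟨l.α, l.memJ⟩ A := rfl

def Em {Pm : MBParams} {S : Type} (R : S → S → ℝ) (t : NSeq Pm) (E : List ℕ → S) : Prop :=
  ∀ p i l, lAt p i t = some l → relS l.d l.α (R (E p) (E (p ++ [i])))

def Ok {Pm : MBParams} {S : Type} (R : S → S → ℝ) (V : ℕ → Set S) (s : S)
    (Γ Δ : Finset (MBForm Pm)) : Prop :=
  (∀ A ∈ Γ, s ∈ A.valR R V) ∧ (∀ A ∈ Δ, s ∉ A.valR R V)

def Fa {Pm : MBParams} {S : Type} (R : S → S → ℝ) (V : ℕ → Set S) (t : NSeq Pm)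
    (E : List ℕ → S) : Prop :=
  ∀ p Γ Δ, sAt p t = some (Γ, Δ) → Ok R V (E p) Γ Δ

theorem Fa_setSeq {Pm : MBParams} {S : Type} {R : S → S → ℝ} {V : ℕ → Set S} {t : NSeq Pm}
    {E : List ℕ → S} {p Γ Δ ts Γ' Δ'} (h : SubAt t p (.node Γ Δ ts)) :
    Fa R V (t.setSeq p Γ' Δ') E ↔ Ok R V (E p) Γ' Δ' ∧
      ∀ q Γ Δ, q ≠ p → sAt q t = some (Γ, Δ) → Ok R V (E q) Γ Δ := by
  have h := h.sAt rfl
  constructor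
  · intro hf
    refine ⟨hf p _ _ (by simp [sAt_setSeq, h]), fun q Γ Δ hq hs => hf q _ _ ?_⟩
    simp [sAt_setSeq, hq, hs]
  · rintro ⟨h1, h2⟩ q Γ1 Δ1 hs
    rw [sAt_setSeq] at hs
    by_cases hq : q = p
    · subst hq
      simp [h] at hs
      obtain ⟨rfl, rfl⟩ := hs
      exact h1
    · rw [if_neg hq] at hs
      exact h2 _ _ _ hq hs

theorem Fa_of_setSeq {Pm : MBParams} {S : Type} {R : S → S → ℝ} {V : ℕ → Set S} {t : NSeq Pm}
    {E : List ℕ → S} {p Γ Δ ts Γ' Δ'} (h : SubAt t p (.node Γ Δ ts)) (h1 : Γ ⊆ Γ') (h2 : Δ ⊆ Δ')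
    (hf : Fa R V (t.setSeq p Γ' Δ') E) : Fa R V t E := by
  rw [← h.setSeq_self rfl, Fa_setSeq h]
  obtain ⟨h3, h4⟩ := (Fa_setSeq h).1 hf
  exact ⟨⟨fun A hA => h3.1 A (h1 hA), fun A hA => h3.2 A (h2 hA)⟩, h4⟩

theorem Fa_setSeq' {Pm : MBParams} {S : Type} {R : S → S → ℝ} {V : ℕ → Set S} {t : NSeq Pm}
    {E : List ℕ → S} {p Γ Δ ts Γ' Δ'} (h : SubAt t p (.node Γ Δ ts))
    (hf : Fa R V t E) (ho : Ok R V (E p) Γ' Δ') : Fa R V (t.setSeq p Γ' Δ') E :=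
  (Fa_setSeq h).2 ⟨ho, fun q _ _ _ hs => hf q _ _ hs⟩

theorem Em_setSeq {Pm : MBParams} {S : Type} {R : S → S → ℝ} {t : NSeq Pm}
    {E : List ℕ → S} {p Γ' Δ'} : Em R (t.setSeq p Γ' Δ') E ↔ Em R t E := by
  simp [Em, lAt_setSeq]

theorem Ok_insL {Pm : MBParams} {S : Type} {R : S → S → ℝ} {V : ℕ → Set S} {s : S}
    {Γ Δ : Finset (MBForm Pm)} {A} :
    Ok R V s (insert A Γ) Δ ↔ s ∈ A.valR R V ∧ Ok R V s Γ Δ := by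
  simp [Ok, and_assoc]

theorem Ok_insR {Pm : MBParams} {S : Type} {R : S → S → ℝ} {V : ℕ → Set S} {s : S}
    {Γ Δ : Finset (MBForm Pm)} {A} :
    Ok R V s Γ (insert A Δ) ↔ s ∉ A.valR R V ∧ Ok R V s Γ Δ := by
  simp only [Ok, Finset.forall_mem_insert]; tauto

theorem Ok_at {Pm : MBParams} {S : Type} {R : S → S → ℝ} {V : ℕ → Set S} {t : NSeq Pm}
    {E : List ℕ → S} {p Γ Δ ts Γ' Δ'} (h : SubAt t p (.node Γ Δ ts))
    (hf : Fa R V (t.setSeq p Γ' Δ') E) : Ok R V (E p) Γ' Δ' := ((Fa_setSeq h).1 hf).1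

theorem sound {Pm : MBParams} {S : Type} {R : S → S → ℝ} {V : ℕ → Set S}
    (h0 : ∀ s t, 0 ≤ R s t) (h1 : ∀ s t, 1 ≤ R s t ↔ s = t) (hle : ∀ s t, R s t ≤ 1)
    (hs : ∀ s t, R s t = R t s) {b : Bool} {t : NSeq Pm} (h : Provable b t) :
    ∀ E, Em R t E → Fa R V t E → False := by
  induction h with
  | axId hp hA hB =>
      intro E _ hf
      have := hf _ _ _ (hp.sAt rfl)
      exact this.2 _ hB (this.1 _ hA)
  | axTop hp hA =>
      intro E _ hf
      exact (hf _ _ _ (hp.sAt rfl)).2 _ hA (by simp [MBForm.valR])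
  | axBot hp hA =>
      intro E _ hf
      simpa [MBForm.valR] using (hf _ _ _ (hp.sAt rfl)).1 _ hA
  | axBoxO1 hp hA =>
      intro E _ hf
      refine (hf _ _ _ (hp.sAt rfl)).2 _ hA ?_
      simp only [MBForm.valR, Set.mem_ofPred_eq]
      intro t ht
      exact absurd ht (not_lt.2 (hle _ _))
  | @cutR t p Γ Δ ts A hp _ _ ih1 ih2 =>
      intro E he hf
      have ho := hf _ _ _ (hp.sAt rfl)
      by_cases hA : E p ∈ A.valR R V
      · exact ih2 E (Em_setSeq.2 he) (Fa_setSeq' hp hf (Ok_insL.2 ⟨hA, ho⟩))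
      · exact ih1 E (Em_setSeq.2 he) (Fa_setSeq' hp hf (Ok_insR.2 ⟨hA, ho⟩))
  | wL hp _ ih =>
      intro E he hf
      exact ih E (Em_setSeq.1 he) (Fa_of_setSeq hp (by simp) (by simp) hf)
  | wR hp _ ih =>
      intro E he hf
      exact ih E (Em_setSeq.1 he) (Fa_of_setSeq hp (by simp) (by simp) hf)
  | negL hp _ ih =>
      intro E he hf
      have hf' := Fa_of_setSeq hp (by simp) (by simp) hf
      have ho := Ok_at hp hf
      rw [Ok_insL] at ho
      exact ih E (Em_setSeq.2 (Em_setSeq.1 he)) (Fa_setSeq' hp hf' (Ok_insR.2 ho))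
  | negR hp _ ih =>
      intro E he hf
      have hf' := Fa_of_setSeq hp (by simp) (by simp) hf
      have ho := Ok_at hp hf
      rw [Ok_insR] at ho
      refine ih E (Em_setSeq.2 (Em_setSeq.1 he)) (Fa_setSeq' hp hf' (Ok_insL.2 ⟨?_, ho.2⟩))
      simpa [MBForm.valR] using ho.1
  | andL hp _ ih =>
      intro E he hf
      have hf' := Fa_of_setSeq hp (by simp) (by simp) hf
      have ho := Ok_at hp hf
      rw [Ok_insL] at ho
      exact ih E (Em_setSeq.2 (Em_setSeq.1 he))
        (Fa_setSeq' hp hf' (Ok_insL.2 ⟨ho.1.1, Ok_insL.2 ⟨ho.1.2, ho.2⟩⟩))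
  | @andR _ t p Γ Δ ts A B hp _ _ ih1 ih2 =>
      intro E he hf
      have hf' := Fa_of_setSeq hp (by simp) (by simp) hf
      have ho := Ok_at hp hf
      rw [Ok_insR] at ho
      by_cases hA : E p ∈ A.valR R V
      · exact ih2 E (Em_setSeq.2 (Em_setSeq.1 he))
          (Fa_setSeq' hp hf' (Ok_insR.2 ⟨fun hB => ho.1 ⟨hA, hB⟩, ho.2⟩))
      · exact ih1 E (Em_setSeq.2 (Em_setSeq.1 he))
          (Fa_setSeq' hp hf' (Ok_insR.2 ⟨hA, ho.2⟩))
  | boxL hp hg hq hl _ ih =>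
      intro E he hf
      have hf' := Fa_of_setSeq hp (by simp) (by simp) hf
      have ho := Ok_at hp hf
      have he' := Em_setSeq.1 he
      rw [Ok_insL, mem_mkBox] at ho
      refine ih E (Em_setSeq.2 he') (Fa_setSeq' hq hf' (Ok_insL.2 ⟨ho.1 _ ?_, hf' _ _ _ (hq.sAt rfl)⟩))
      exact relS_of_pleq hl (he' _ _ _ (by rw [hp.lAt rfl, hg]; rfl))
  | boxLsym hp hg hq hl _ ih =>
      intro E he hf
      have hf' := Fa_of_setSeq hq (by simp) (by simp) hf
      have ho := Ok_at hq hf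
      have he' := Em_setSeq.1 he
      rw [Ok_insL, mem_mkBox] at ho
      refine ih E (Em_setSeq.2 he') (Fa_setSeq' hp hf' (Ok_insL.2 ⟨ho.1 _ ?_, hf' _ _ _ (hp.sAt rfl)⟩))
      rw [hs]
      exact relS_of_pleq hl (he' _ _ _ (by rw [hp.lAt rfl, hg]; rfl))
  | @boxLself _ t p Γ Δ ts A α d hp hne _ ih =>
      intro E he hf
      have hf' := Fa_of_setSeq hp (by simp) (by simp) hf
      have ho := Ok_at hp hf
      rw [Ok_insL, mem_mkBox] at ho
      refine ih E (Em_setSeq.2 (Em_setSeq.1 he)) (Fa_setSeq' hp hf' (Ok_insL.2 ⟨ho.1 _ ?_, ho.2⟩))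
      have h11 : R (E p) (E p) = 1 := le_antisymm (hle _ _) ((h1 _ _).2 rfl)
      have hα := (Pm.subI α.2).2
      rw [h11]
      cases d with
      | c => exact hα
      | o => exact lt_of_le_of_ne hα (fun e => hne ⟨e, rfl⟩)
  | boxC0 hp hq _ ih =>
      intro E he hf
      have hf' := Fa_of_setSeq hq (by simp) (by simp) hf
      have ho := Ok_at hq hf
      rw [Ok_insL] at ho
      exact ih E (Em_setSeq.2 (Em_setSeq.1 he))
        (Fa_setSeq' hp hf' (Ok_insL.2 ⟨ho.1 _ (h0 _ _), hf' _ _ _ (hp.sAt rfl)⟩))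
  | @boxR _ t p Γ Δ ts A l hp _ ih =>
      intro E he hf
      have hf' := Fa_of_setSeq hp (by simp) (by simp) hf
      have ho := Ok_at hp hf
      have he' := Em_setSeq.1 he
      rw [Ok_insR, box_eq, mem_mkBox] at ho
      obtain ⟨ho, _⟩ := ho
      push Not at ho
      obtain ⟨w, hw1, hw2⟩ := ho
      have hnl : lAt p (nlen ts) t = none := by rw [hp.lAt rfl, get_nlen]; rfl
      have hns : sAt (p ++ [nlen ts]) t = none := sAt_none _ _ _ hnl
      refine ih (Function.update E (p ++ [nlen ts]) w) ?_ ?_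
      · intro q i l' hl
        rw [hp.lAt_addChild _ _ _ rfl] at hl
        split_ifs at hl with hc
        · obtain ⟨rfl, rfl⟩ := hc
          simp only [Option.some.injEq] at hl
          subst hl
          rw [Function.update_self, Function.update_of_ne (by simp)]
          exact hw1
        · obtain ⟨⟨x, hx⟩, _⟩ := sAt_of_lAt _ _ _ _ hl
          rw [Function.update_of_ne, Function.update_of_ne]
          · exact he' _ _ _ hl
          · intro e
            apply hc
            have := List.append_inj' e rfl
            simpa using this
          · rintro rfl
            simp [hns] at hx
      · intro q Γ1 Δ1 hq
        rw [hp.sAt_addChild _ _ _ rfl] at hq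
        split_ifs at hq with hc
        · subst hc
          simp only [Option.some.injEq, Prod.mk.injEq] at hq
          obtain ⟨rfl, rfl⟩ := hq
          rw [Function.update_self]
          simpa [Ok] using hw2
        · rw [Function.update_of_ne hc]
          exact hf' _ _ _ hq
  | @boxRself _ t p Γ Δ ts A hp _ ih =>
      intro E he hf
      have hf' := Fa_of_setSeq hp (by simp) (by simp) hf
      have ho := Ok_at hp hf
      rw [Ok_insR] at ho
      refine ih E (Em_setSeq.2 (Em_setSeq.1 he)) (Fa_setSeq' hp hf' (Ok_insR.2 ⟨?_, ho.2⟩))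
      intro hA
      apply ho.1
      intro t ht
      rw [← (h1 _ _).1 ht]
      exact hA

/-! ### Saturation -/

def inL {Pm : MBParams} (t : NSeq Pm) (p : List ℕ) (A : MBForm Pm) : Prop :=
  ∃ Γ Δ, sAt p t = some (Γ, Δ) ∧ A ∈ Γ

def inR {Pm : MBParams} (t : NSeq Pm) (p : List ℕ) (A : MBForm Pm) : Prop :=
  ∃ Γ Δ, sAt p t = some (Γ, Δ) ∧ A ∈ Δ

def nd {Pm : MBParams} (t : NSeq Pm) (p : List ℕ) : Prop := ∃ x, sAt p t = some x

structure Le {Pm : MBParams} (t t' : NSeq Pm) : Prop where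
  l : ∀ p A, inL t p A → inL t' p A
  r : ∀ p A, inR t p A → inR t' p A
  n : ∀ p, nd t p → nd t' p
  e : ∀ p i l, lAt p i t = some l → lAt p i t' = some l

theorem Le.rfl' {Pm : MBParams} (t : NSeq Pm) : Le t t :=
  ⟨fun _ _ h => h, fun _ _ h => h, fun _ h => h, fun _ _ _ h => h⟩

theorem Le.trans {Pm : MBParams} {t u v : NSeq Pm} (h : Le t u) (h' : Le u v) : Le t v :=
  ⟨fun _ _ x => h'.l _ _ (h.l _ _ x), fun _ _ x => h'.r _ _ (h.r _ _ x),
   fun _ x => h'.n _ (h.n _ x), fun _ _ _ x => h'.e _ _ _ (h.e _ _ _ x)⟩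

theorem Le_setSeq {Pm : MBParams} {t : NSeq Pm} {p Γ Δ Γ' Δ'}
    (h : sAt p t = some (Γ, Δ)) (h1 : Γ ⊆ Γ') (h2 : Δ ⊆ Δ') : Le t (t.setSeq p Γ' Δ') := by
  refine ⟨?_, ?_, ?_, fun q i l hl => by rwa [lAt_setSeq]⟩
  · rintro q A ⟨Γ1, Δ1, hs, hA⟩
    by_cases hq : q = p
    · subst hq
      rw [h] at hs
      simp only [Option.some.injEq, Prod.mk.injEq] at hs
      obtain ⟨rfl, rfl⟩ := hs
      exact ⟨Γ', Δ', by simp [sAt_setSeq, h], h1 hA⟩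
    · exact ⟨Γ1, Δ1, by simp [sAt_setSeq, hq, hs], hA⟩
  · rintro q A ⟨Γ1, Δ1, hs, hA⟩
    by_cases hq : q = p
    · subst hq
      rw [h] at hs
      simp only [Option.some.injEq, Prod.mk.injEq] at hs
      obtain ⟨rfl, rfl⟩ := hs
      exact ⟨Γ', Δ', by simp [sAt_setSeq, h], h2 hA⟩
    · exact ⟨Γ1, Δ1, by simp [sAt_setSeq, hq, hs], hA⟩
  · rintro q ⟨x, hx⟩
    by_cases hq : q = p
    · subst hq
      exact ⟨(Γ', Δ'), by simp [sAt_setSeq, h]⟩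
    · exact ⟨x, by simp [sAt_setSeq, hq, hx]⟩

theorem sAt_setSeq_self {Pm : MBParams} {t : NSeq Pm} {p Γ Δ Γ' Δ'}
    (h : sAt p t = some (Γ, Δ)) : sAt p (t.setSeq p Γ' Δ') = some (Γ', Δ') := by
  simp [sAt_setSeq, h]

inductive Req (Pm : MBParams) : Type
  | negL : List ℕ → MBForm Pm → Req Pm
  | negR : List ℕ → MBForm Pm → Req Pm
  | andL : List ℕ → MBForm Pm → MBForm Pm → Req Pm
  | andR : List ℕ → MBForm Pm → MBForm Pm → Req Pm
  | boxL : List ℕ → ℕ → Side → Pm.J → MBForm Pm → Req Pm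
  | boxLsym : List ℕ → ℕ → Side → Pm.J → MBForm Pm → Req Pm
  | boxLself : List ℕ → Side → Pm.J → MBForm Pm → Req Pm
  | boxC0 : List ℕ → List ℕ → MBForm Pm → Req Pm
  | boxR : List ℕ → MBLab Pm → MBForm Pm → Req Pm
  | boxRself : List ℕ → MBForm Pm → Req Pm

def Req.Prem {Pm : MBParams} (t : NSeq Pm) : Req Pm → Prop
  | negL p A => inL t p (.neg A)
  | negR p A => inR t p (.neg A)
  | andL p A B => inL t p (.conj A B)
  | andR p A B => inR t p (.conj A B)
  | boxL p i d α A => inL t p (mkBox d α A) ∧ ∃ l, lAt p i t = some l ∧ pleq α d l.α l.d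
  | boxLsym p i d α A =>
      inL t (p ++ [i]) (mkBox d α A) ∧ ∃ l, lAt p i t = some l ∧ pleq α d l.α l.d
  | boxLself p d α A => inL t p (mkBox d α A) ∧ ¬((α : ℝ) = 1 ∧ d = Side.o)
  | boxC0 p q A => inL t p (.boxc ⟨0, Pm.zero_mem⟩ A) ∧ nd t q
  | boxR p l A => inR t p (l.box A)
  | boxRself p A => inR t p (.boxc ⟨1, Pm.one_mem⟩ A)

def Req.Conc {Pm : MBParams} (t : NSeq Pm) : Req Pm → Prop
  | negL p A => inR t p A
  | negR p A => inL t p A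
  | andL p A B => inL t p A ∧ inL t p B
  | andR p A B => inR t p A ∨ inR t p B
  | boxL p i _ _ A => inL t (p ++ [i]) A
  | boxLsym p _ _ _ A => inL t p A
  | boxLself p _ _ A => inL t p A
  | boxC0 _ q A => inL t q A
  | boxR p l A => ∃ i, lAt p i t = some l ∧ inR t (p ++ [i]) A
  | boxRself p A => inR t p A

theorem Req.Prem.mono {Pm : MBParams} {t t' : NSeq Pm} (h : Le t t') (r : Req Pm)
    (hr : r.Prem t) : r.Prem t' := by
  cases r with
  | negL p A => exact h.l _ _ hr
  | negR p A => exact h.r _ _ hr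
  | andL p A B => exact h.l _ _ hr
  | andR p A B => exact h.r _ _ hr
  | boxL p i d α A =>
      obtain ⟨h1, l, h2, h3⟩ := hr
      exact ⟨h.l _ _ h1, l, h.e _ _ _ h2, h3⟩
  | boxLsym p i d α A =>
      obtain ⟨h1, l, h2, h3⟩ := hr
      exact ⟨h.l _ _ h1, l, h.e _ _ _ h2, h3⟩
  | boxLself p d α A => exact ⟨h.l _ _ hr.1, hr.2⟩
  | boxC0 p q A => exact ⟨h.l _ _ hr.1, h.n _ hr.2⟩
  | boxR p l A => exact h.r _ _ hr
  | boxRself p A => exact h.r _ _ hr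

theorem step {Pm : MBParams} {t : NSeq Pm} (hu : ¬ Provable false t) (r : Req Pm)
    (hr : r.Prem t) : ∃ t', Le t t' ∧ ¬ Provable false t' ∧ r.Conc t' := by
  cases r with
  | negL p A =>
      obtain ⟨Γ, Δ, hs, hA⟩ := hr
      obtain ⟨ts, hp⟩ := subAt_of_sAt _ _ hs
      refine ⟨_, Le_setSeq hs (Γ' := Γ) (Δ' := insert A Δ) (by simp) (by simp), fun hc => hu ?_,
        _, _, sAt_setSeq_self hs, by simp⟩
      have := Provable.negL hp hc
      rwa [Finset.insert_eq_of_mem hA, hp.setSeq_self rfl] at this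
  | negR p A =>
      obtain ⟨Γ, Δ, hs, hA⟩ := hr
      obtain ⟨ts, hp⟩ := subAt_of_sAt _ _ hs
      refine ⟨_, Le_setSeq hs (Γ' := insert A Γ) (Δ' := Δ) (by simp) (by simp), fun hc => hu ?_,
        _, _, sAt_setSeq_self hs, by simp⟩
      have := Provable.negR hp hc
      rwa [Finset.insert_eq_of_mem hA, hp.setSeq_self rfl] at this
  | andL p A B =>
      obtain ⟨Γ, Δ, hs, hA⟩ := hr
      obtain ⟨ts, hp⟩ := subAt_of_sAt _ _ hs
      refine ⟨_, Le_setSeq hs (Γ' := insert A (insert B Γ)) (Δ' := Δ)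
        ((Finset.subset_insert _ _).trans (Finset.subset_insert _ _)) (by simp), fun hc => hu ?_,
        ⟨_, _, sAt_setSeq_self hs, by simp⟩, ⟨_, _, sAt_setSeq_self hs, by simp⟩⟩
      have := Provable.andL hp hc
      rwa [Finset.insert_eq_of_mem hA, hp.setSeq_self rfl] at this
  | andR p A B =>
      obtain ⟨Γ, Δ, hs, hA⟩ := hr
      obtain ⟨ts, hp⟩ := subAt_of_sAt _ _ hs
      by_cases hc1 : Provable false (t.setSeq p Γ (insert A Δ))
      · refine ⟨_, Le_setSeq hs (Γ' := Γ) (Δ' := insert B Δ) (by simp) (by simp), fun hc => hu ?_,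
          Or.inr ⟨_, _, sAt_setSeq_self hs, by simp⟩⟩
        have := Provable.andR hp hc1 hc
        rwa [Finset.insert_eq_of_mem hA, hp.setSeq_self rfl] at this
      · exact ⟨_, Le_setSeq hs (Γ' := Γ) (Δ' := insert A Δ) (by simp) (by simp), hc1,
          Or.inl ⟨_, _, sAt_setSeq_self hs, by simp⟩⟩
  | boxL p i d α A =>
      obtain ⟨⟨Γ, Δ, hs, hA⟩, l, hl, hle⟩ := hr
      obtain ⟨ts, hp⟩ := subAt_of_sAt _ _ hs
      obtain ⟨_, ⟨⟨Γ1, Δ1⟩, hs1⟩⟩ := sAt_of_lAt _ _ _ _ hl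
      obtain ⟨ts1, hp1⟩ := subAt_of_sAt _ _ hs1
      rw [hp.lAt rfl, Option.map_eq_some_iff] at hl
      obtain ⟨⟨l', u⟩, hg, rfl⟩ := hl
      refine ⟨_, Le_setSeq hs1 (Γ' := insert A Γ1) (Δ' := Δ1) (by simp) (by simp), fun hc => hu ?_,
        _, _, sAt_setSeq_self hs1, by simp⟩
      have := Provable.boxL hp hg hp1 hle hc
      rwa [Finset.insert_eq_of_mem hA, hp.setSeq_self rfl] at this
  | boxLsym p i d α A =>
      obtain ⟨⟨Γ1, Δ1, hs1, hA⟩, l, hl, hle⟩ := hr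
      obtain ⟨ts1, hp1⟩ := subAt_of_sAt _ _ hs1
      obtain ⟨⟨⟨Γ, Δ⟩, hs⟩, _⟩ := sAt_of_lAt _ _ _ _ hl
      obtain ⟨ts, hp⟩ := subAt_of_sAt _ _ hs
      rw [hp.lAt rfl, Option.map_eq_some_iff] at hl
      obtain ⟨⟨l', u⟩, hg, rfl⟩ := hl
      refine ⟨_, Le_setSeq hs (Γ' := insert A Γ) (Δ' := Δ) (by simp) (by simp), fun hc => hu ?_,
        _, _, sAt_setSeq_self hs, by simp⟩
      have := Provable.boxLsym hp hg hp1 hle hc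
      rwa [Finset.insert_eq_of_mem hA, hp1.setSeq_self rfl] at this
  | boxLself p d α A =>
      obtain ⟨⟨Γ, Δ, hs, hA⟩, hne⟩ := hr
      obtain ⟨ts, hp⟩ := subAt_of_sAt _ _ hs
      refine ⟨_, Le_setSeq hs (Γ' := insert A Γ) (Δ' := Δ) (by simp) (by simp), fun hc => hu ?_,
        _, _, sAt_setSeq_self hs, by simp⟩
      have := Provable.boxLself hp hne hc
      rwa [Finset.insert_eq_of_mem hA, hp.setSeq_self rfl] at this
  | boxC0 p q A =>
      obtain ⟨⟨Γ, Δ, hs, hA⟩, ⟨Γ1, Δ1⟩, hs1⟩ := hr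
      obtain ⟨ts, hp⟩ := subAt_of_sAt _ _ hs
      obtain ⟨ts1, hp1⟩ := subAt_of_sAt _ _ hs1
      refine ⟨_, Le_setSeq hs1 (Γ' := insert A Γ1) (Δ' := Δ1) (by simp) (by simp), fun hc => hu ?_,
        _, _, sAt_setSeq_self hs1, by simp⟩
      have := Provable.boxC0 hp1 hp hc
      rwa [Finset.insert_eq_of_mem hA, hp.setSeq_self rfl] at this
  | boxR p l A =>
      obtain ⟨Γ, Δ, hs, hA⟩ := hr
      obtain ⟨ts, hp⟩ := subAt_of_sAt _ _ hs
      have hS := hp.sAt_addChild l ∅ {A} rfl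
      have hL := hp.lAt_addChild l ∅ {A} rfl
      have hnl : lAt p (nlen ts) t = none := by rw [hp.lAt rfl, get_nlen]; rfl
      have hns : sAt (p ++ [nlen ts]) t = none := sAt_none _ _ _ hnl
      have hS' : ∀ q x, sAt q t = some x →
          sAt q (t.addChild p l (.node ∅ {A} .nil)) = some x := by
        intro q x hx
        rw [hS, if_neg, hx]
        rintro rfl
        simp [hns] at hx
      refine ⟨t.addChild p l (.node ∅ {A} .nil), ⟨?_, ?_, ?_, ?_⟩, fun hc => hu ?_,
        nlen ts, by rw [hL]; simp, ∅, {A}, by rw [hS]; simp, by simp⟩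
      · rintro q B ⟨Γ1, Δ1, h1, h2⟩
        exact ⟨_, _, hS' _ _ h1, h2⟩
      · rintro q B ⟨Γ1, Δ1, h1, h2⟩
        exact ⟨_, _, hS' _ _ h1, h2⟩
      · rintro q ⟨x, hx⟩
        exact ⟨_, hS' _ _ hx⟩
      · intro q i l' h
        rw [hL, if_neg, h]
        rintro ⟨rfl, rfl⟩
        simp [hnl] at h
      · have := Provable.boxR hp hc
        rwa [Finset.insert_eq_of_mem hA, hp.setSeq_self rfl] at this
  | boxRself p A =>
      obtain ⟨Γ, Δ, hs, hA⟩ := hr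
      obtain ⟨ts, hp⟩ := subAt_of_sAt _ _ hs
      refine ⟨_, Le_setSeq hs (Γ' := Γ) (Δ' := insert A Δ) (by simp) (by simp), fun hc => hu ?_,
        _, _, sAt_setSeq_self hs, by simp⟩
      have := Provable.boxRself hp hc
      rwa [Finset.insert_eq_of_mem hA, hp.setSeq_self rfl] at this

/-! ### Countability -/

def code {Pm : MBParams} (e : Pm.J → ℕ) : MBForm Pm → ℕ
  | .var n => Nat.pair 0 n
  | .top => Nat.pair 1 0
  | .bot => Nat.pair 2 0
  | .neg A => Nat.pair 3 (code e A)
  | .conj A B => Nat.pair 4 (Nat.pair (code e A) (code e B))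
  | .boxc α A => Nat.pair 5 (Nat.pair (e α) (code e A))
  | .boxo α A => Nat.pair 6 (Nat.pair (e α) (code e A))

theorem code_inj {Pm : MBParams} {e : Pm.J → ℕ} (he : Function.Injective e) :
    ∀ A B : MBForm Pm, code e A = code e B → A = B := by
  intro A
  induction A with
  | var n => intro B h; cases B <;> simp_all [code, Nat.pair_eq_pair]
  | top => intro B h; cases B <;> simp_all [code, Nat.pair_eq_pair]
  | bot => intro B h; cases B <;> simp_all [code, Nat.pair_eq_pair]
  | neg A ih =>
      intro B h
      cases B <;> simp [code, Nat.pair_eq_pair] at h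
      rw [ih _ h]
  | conj A A' ih ih' =>
      intro B h
      cases B <;> simp [code, Nat.pair_eq_pair] at h
      rw [ih _ h.1, ih' _ h.2]
  | boxc α A ih =>
      intro B h
      cases B <;> simp [code, Nat.pair_eq_pair] at h
      rw [ih _ h.2, he h.1]
  | boxo α A ih =>
      intro B h
      cases B <;> simp [code, Nat.pair_eq_pair] at h
      rw [ih _ h.2, he h.1]

theorem countable_form (Pm : MBParams) : Countable (MBForm Pm) := by
  have : Finite Pm.J := Pm.finite
  obtain ⟨e, he⟩ := exists_injective_nat Pm.J
  exact (show Function.Injective (code e) from fun A B h => code_inj he A B h).countable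

theorem mkBox_inj {Pm : MBParams} {d d' : Side} {α α' : Pm.J} {A A' : MBForm Pm}
    (h : mkBox d α A = mkBox d' α' A') : d = d' ∧ α = α' ∧ A = A' := by
  cases d <;> cases d' <;> simp_all [mkBox]

def Req.code {Pm : MBParams} : Req Pm → ℕ × List ℕ × List ℕ × MBForm Pm
  | negL p A => (0, p, [], A)
  | negR p A => (1, p, [], A)
  | andL p A B => (2, p, [], .conj A B)
  | andR p A B => (3, p, [], .conj A B)
  | boxL p i d α A => (4, p, [i], mkBox d α A)
  | boxLsym p i d α A => (5, p, [i], mkBox d α A)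
  | boxLself p d α A => (6, p, [], mkBox d α A)
  | boxC0 p q A => (7, p, q, A)
  | boxR p l A => (8, p, [], l.box A)
  | boxRself p A => (9, p, [], A)

theorem Req.code_inj {Pm : MBParams} : Function.Injective (Req.code (Pm := Pm)) := by
  intro r s h
  cases r <;> cases s <;> simp [Req.code] at h
  case boxL => obtain ⟨rfl, rfl, h⟩ := h; obtain ⟨rfl, rfl, rfl⟩ := mkBox_inj h; rfl
  case boxLsym => obtain ⟨rfl, rfl, h⟩ := h; obtain ⟨rfl, rfl, rfl⟩ := mkBox_inj h; rfl
  case boxLself => obtain ⟨rfl, h⟩ := h; obtain ⟨rfl, rfl, rfl⟩ := mkBox_inj h; rfl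
  case boxR p l A p' l' A' =>
    obtain ⟨rfl, h⟩ := h
    rw [box_eq, box_eq] at h
    obtain ⟨h1, h2, rfl⟩ := mkBox_inj h
    cases l; cases l'
    simp_all
  all_goals simp_all

theorem exists_seq {Pm : MBParams} (t : NSeq Pm) (hu : ¬ Provable false t) :
    ∃ f : ℕ → NSeq Pm, f 0 = t ∧ (∀ n, ¬ Provable false (f n)) ∧ (∀ m n, m ≤ n → Le (f m) (f n)) ∧
      ∀ (r : Req Pm) n, r.Prem (f n) → ∃ m, r.Conc (f m) := by
  have := countable_form Pm
  have : Countable (Req Pm) := Req.code_inj.countable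
  have : Nonempty (Req Pm) := ⟨.negL [] .top⟩
  obtain ⟨g, hg⟩ := exists_surjective_nat (Req Pm)
  have hstep : ∀ (r : Req Pm) (x : {t : NSeq Pm // ¬ Provable false t}),
      ∃ y : {t : NSeq Pm // ¬ Provable false t}, Le x.1 y.1 ∧ (r.Prem x.1 → r.Conc y.1) := by
    intro r x
    by_cases hr : r.Prem x.1
    · obtain ⟨t', h1, h2, h3⟩ := step x.2 r hr
      exact ⟨⟨t', h2⟩, h1, fun _ => h3⟩
    · exact ⟨x, Le.rfl' _, fun h => absurd h hr⟩
  choose F hF1 hF2 using hstep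
  let f : ℕ → {t : NSeq Pm // ¬ Provable false t} :=
    fun n => Nat.rec ⟨t, hu⟩ (fun n x => F (g n.unpair.1) x) n
  have hmono : ∀ m n, m ≤ n → Le (f m).1 (f n).1 := by
    intro m n h
    induction n, h using Nat.le_induction with
    | base => exact Le.rfl' _
    | succ n _ ih => exact ih.trans (hF1 _ _)
  refine ⟨fun n => (f n).1, rfl, fun n => (f n).2, hmono, fun r n hr => ?_⟩
  obtain ⟨i, rfl⟩ := hg r
  refine ⟨Nat.pair i n + 1, ?_⟩
  have := hF2 (g i) (f (Nat.pair i n)) (hr.mono (hmono _ _ (Nat.right_le_pair i n)))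
  have e : f (Nat.pair i n + 1) = F (g (Nat.pair i n).unpair.1) (f (Nat.pair i n)) := rfl
  rw [Nat.unpair_pair] at e
  change Req.Conc (f (Nat.pair i n + 1)).1 (g i)
  rw [e]
  exact this

/-! ### The countermodel -/

theorem exists_suc (Pm : MBParams) (a : ℝ) (ha : a < 1) :
    ∃ s, a < s ∧ s < 1 ∧ ∀ x ∈ Pm.J, x ≤ s → x ≤ a := by
  have hfin : (Pm.J ∩ Set.Ioi a).Finite := Pm.finite.subset Set.inter_subset_left
  obtain ⟨m, hm, hmin⟩ := Set.exists_min_image _ id hfin ⟨1, Pm.one_mem, ha⟩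
  have h1 : a < m := hm.2
  have h2 : m ≤ 1 := hmin 1 ⟨Pm.one_mem, ha⟩
  refine ⟨(a + m) / 2, by linarith, by linarith, fun x hx hxs => ?_⟩
  by_contra hc
  have : m ≤ x := hmin x ⟨hx, not_le.1 hc⟩
  linarith

theorem lab_lt {Pm : MBParams} (l : MBLab Pm) : l.α < 1 :=
  lt_of_le_of_ne (Pm.subI l.memJ).2 l.ne_one

theorem exists_lv {Pm : MBParams} (l : MBLab Pm) :
    ∃ r : ℝ, 0 ≤ r ∧ r < 1 ∧ ∀ (d : Side) (α : Pm.J), relS d α r ↔ pleq α d l.α l.d := by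
  have hl := lab_lt l
  have h0 := (Pm.subI l.memJ).1
  obtain ⟨a, ha, hne, d'⟩ := l
  cases d' with
  | c =>
    refine ⟨a, h0, hl, fun d α => ?_⟩
    cases d <;> simp [relS, pleq]
  | o =>
    obtain ⟨s, hs1, hs2, hs3⟩ := exists_suc Pm a hl
    simp only at h0
    refine ⟨s, by linarith, hs2, fun d α => ?_⟩
    cases d <;> simp only [relS, pleq]
    · exact ⟨hs3 _ α.2, fun h => by linarith⟩
    · exact ⟨fun h => hs3 _ α.2 h.le, fun h => by linarith⟩

theorem complete {Pm : MBParams} (t : NSeq Pm) (hu : ¬ Provable false t) :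
    ∃ (S : Type) (R : S → S → ℝ) (V : ℕ → Set S) (E : List ℕ → S),
      (∀ s t, 0 ≤ R s t) ∧ (∀ s t, 1 ≤ R s t ↔ s = t) ∧ (∀ s t, R s t ≤ 1) ∧
      (∀ s t, R s t = R t s) ∧ Em R t E ∧ Fa R V t E := by
  classical
  obtain ⟨f, hf0, hfu, hmono, hreq⟩ := exists_seq t hu
  choose lv hlv0 hlv1 hlv using @exists_lv Pm
  let S : Type := {p : List ℕ // ∃ n, nd (f n) p}
  let L : List ℕ → MBForm Pm → Prop := fun p A => ∃ n, inL (f n) p A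
  let Rr : List ℕ → MBForm Pm → Prop := fun p A => ∃ n, inR (f n) p A
  let Ed : List ℕ → List ℕ → MBLab Pm → Prop :=
    fun p q l => ∃ i n, q = p ++ [i] ∧ lAt p i (f n) = some l
  have hEd : ∀ p q l l', Ed p q l → Ed p q l' → l = l' := by
    rintro p q l l' ⟨i, n, rfl, h⟩ ⟨j, m, e, h'⟩
    simp only [List.append_cancel_left_eq, List.cons.injEq, and_true] at e
    subst e
    have h1 := (hmono _ _ (le_max_left n m)).e _ _ _ h
    have h2 := (hmono _ _ (le_max_right n m)).e _ _ _ h'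
    rw [h1] at h2
    exact Option.some.inj h2
  have hlen : ∀ p q l, Ed p q l → q.length = p.length + 1 := by
    rintro p q l ⟨i, n, rfl, h⟩; simp
  let Lk : List ℕ → List ℕ → MBLab Pm → Prop := fun p q l => Ed p q l ∨ Ed q p l
  have hLk : ∀ p q l l', Lk p q l → Lk p q l' → l = l' := by
    rintro p q l l' (h | h) (h' | h')
    · exact hEd _ _ _ _ h h'
    · have := hlen _ _ _ h; have := hlen _ _ _ h'; omega
    · have := hlen _ _ _ h; have := hlen _ _ _ h'; omega
    · exact hEd _ _ _ _ h h'
  have hLks : ∀ p q l, Lk p q l ↔ Lk q p l := fun p q l => or_comm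
  have hLkne : ∀ p q l, Lk p q l → p ≠ q := by
    rintro p q l (h | h) rfl <;> have := hlen _ _ _ h <;> omega
  let R : S → S → ℝ := fun p q =>
    if p = q then 1 else if h : ∃ l, Lk p.1 q.1 l then lv h.choose else 0
  have hR1 : ∀ p, R p p = 1 := fun p => by simp [R]
  have hRl : ∀ (p q : S) l, Lk p.1 q.1 l → R p q = lv l := by
    intro p q l h
    have hne : p ≠ q := fun e => hLkne _ _ _ h (congrArg _ e)
    have hex : ∃ l, Lk p.1 q.1 l := ⟨l, h⟩
    simp only [R, if_neg hne, dif_pos hex]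
    rw [hLk _ _ _ _ hex.choose_spec h]
  have hR0 : ∀ (p q : S), p ≠ q → (¬ ∃ l, Lk p.1 q.1 l) → R p q = 0 := by
    intro p q h h'
    simp only [R, if_neg h, dif_neg h']
  have hcases : ∀ p q : S, p = q ∨ (∃ l, Lk p.1 q.1 l) ∨ (p ≠ q ∧ R p q = 0) := by
    intro p q
    by_cases h : p = q
    · exact Or.inl h
    · by_cases h' : ∃ l, Lk p.1 q.1 l
      · exact Or.inr (Or.inl h')
      · exact Or.inr (Or.inr ⟨h, hR0 _ _ h h'⟩)
  let V : ℕ → Set S := fun n => {p | L p.1 (.var n)}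
  have cons : ∀ p A, L p A → Rr p A → False := by
    rintro p A ⟨n, h⟩ ⟨m, h'⟩
    obtain ⟨Γ, Δ, hs, hA⟩ := (hmono _ _ (le_max_left n m)).l _ _ h
    obtain ⟨Γ', Δ', hs', hA'⟩ := (hmono _ _ (le_max_right n m)).r _ _ h'
    rw [hs] at hs'
    simp only [Option.some.injEq, Prod.mk.injEq] at hs'
    obtain ⟨rfl, rfl⟩ := hs'
    obtain ⟨ts, hp⟩ := subAt_of_sAt _ _ hs
    exact hfu _ (Provable.axId hp hA hA')
  have boxTruth : ∀ (A : MBForm Pm) (d : Side) (α : Pm.J),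
      (∀ p : S, (L p.1 A → p ∈ A.valR R V) ∧ (Rr p.1 A → p ∉ A.valR R V)) →
      ∀ p : S, (L p.1 (mkBox d α A) → p ∈ (mkBox d α A).valR R V) ∧
        (Rr p.1 (mkBox d α A) → p ∉ (mkBox d α A).valR R V) := by
    intro A d α ih p
    constructor
    · rintro ⟨n, hn⟩
      rw [mem_mkBox]
      intro q hq
      apply (ih q).1
      rcases hcases p q with rfl | ⟨l, hl⟩ | ⟨hne, h0⟩
      · rw [hR1] at hq
        refine hreq (.boxLself p.1 d α A) n ⟨hn, ?_⟩
        rintro ⟨h1, rfl⟩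
        simp [relS, h1] at hq
      · rw [hRl _ _ _ hl, hlv] at hq
        rcases hl with ⟨i, m, he, hl⟩ | ⟨i, m, he, hl⟩
        · have := hreq (.boxL p.1 i d α A) (max n m) ⟨(hmono _ _ (le_max_left n m)).l _ _ hn, l,
            (hmono _ _ (le_max_right n m)).e _ _ _ hl, hq⟩
          rw [he]
          exact this
        · rw [he] at hn
          exact hreq (.boxLsym q.1 i d α A) (max n m) ⟨(hmono _ _ (le_max_left n m)).l _ _ hn, l,
            (hmono _ _ (le_max_right n m)).e _ _ _ hl, hq⟩
      · rw [h0] at hq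
        have hα := (Pm.subI α.2).1
        cases d with
        | o => exact absurd hq (not_lt.2 hα)
        | c =>
          have hα0 : α = ⟨0, Pm.zero_mem⟩ := Subtype.ext (le_antisymm hq hα)
          subst hα0
          obtain ⟨m, hm⟩ := q.2
          exact hreq (.boxC0 p.1 q.1 A) (max n m) ⟨(hmono _ _ (le_max_left n m)).l _ _ hn,
            (hmono _ _ (le_max_right n m)).n _ hm⟩
    · rintro ⟨n, hn⟩ hval
      rw [mem_mkBox] at hval
      by_cases hα : (α : ℝ) = 1
      · have hα1 : α = ⟨1, Pm.one_mem⟩ := Subtype.ext hα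
        subst hα1
        cases d with
        | o =>
          obtain ⟨Γ, Δ, hs, hA⟩ := hn
          obtain ⟨ts, hp⟩ := subAt_of_sAt _ _ hs
          exact hfu _ (Provable.axBoxO1 hp hA)
        | c =>
          refine (ih p).2 (hreq (.boxRself p.1 A) n hn) (hval p ?_)
          simp [relS, hR1]
      · obtain ⟨m, i, hl, hA⟩ := hreq (.boxR p.1 ⟨α, α.2, hα, d⟩ A) n hn
        have hnd := (sAt_of_lAt _ _ _ _ hl).2
        refine (ih ⟨p.1 ++ [i], m, hnd⟩).2 ⟨m, hA⟩ (hval _ ?_)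
        rw [hRl p ⟨p.1 ++ [i], m, hnd⟩ _ (Or.inl ⟨i, m, rfl, hl⟩), hlv]
        cases d <;> simp [pleq]
  have truth : ∀ (A : MBForm Pm) (p : S),
      (L p.1 A → p ∈ A.valR R V) ∧ (Rr p.1 A → p ∉ A.valR R V) := by
    intro A
    induction A with
    | var n => exact fun p => ⟨fun h => h, fun h h' => cons _ _ h' h⟩
    | top =>
      refine fun p => ⟨fun h => by simp [MBForm.valR], ?_⟩
      rintro ⟨n, Γ, Δ, hs, hA⟩
      obtain ⟨ts, hp⟩ := subAt_of_sAt _ _ hs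
      exact absurd (Provable.axTop hp hA) (hfu _)
    | bot =>
      refine fun p => ⟨?_, fun h => by simp [MBForm.valR]⟩
      rintro ⟨n, Γ, Δ, hs, hA⟩
      obtain ⟨ts, hp⟩ := subAt_of_sAt _ _ hs
      exact absurd (Provable.axBot hp hA) (hfu _)
    | neg A ih =>
      refine fun p => ⟨?_, ?_⟩
      · rintro ⟨n, h⟩
        exact (ih p).2 (hreq (.negL p.1 A) n h)
      · rintro ⟨n, h⟩ h'
        exact h' ((ih p).1 (hreq (.negR p.1 A) n h))
    | conj A B ihA ihB =>
      refine fun p => ⟨?_, ?_⟩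
      · rintro ⟨n, h⟩
        obtain ⟨m, h1, h2⟩ := hreq (.andL p.1 A B) n h
        exact ⟨(ihA p).1 ⟨m, h1⟩, (ihB p).1 ⟨m, h2⟩⟩
      · rintro ⟨n, h⟩ h'
        obtain ⟨m, h1 | h1⟩ := hreq (.andR p.1 A B) n h
        · exact (ihA p).2 ⟨m, h1⟩ h'.1
        · exact (ihB p).2 ⟨m, h1⟩ h'.2
    | boxc α A ih => exact boxTruth A .c α ih
    | boxo α A ih => exact boxTruth A .o α ih
  have hroot : ∃ n, nd (f n) [] := by
    refine ⟨0, ?_⟩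
    rcases f 0 with ⟨Γ, Δ, ts⟩
    exact ⟨_, rfl⟩
  let E : List ℕ → S := fun p => if h : ∃ n, nd (f n) p then ⟨p, h⟩ else ⟨[], hroot⟩
  have hE : ∀ p, nd t p → (E p).1 = p := by
    intro p h
    have : ∃ n, nd (f n) p := ⟨0, by rw [hf0]; exact h⟩
    simp only [E, dif_pos this]
  refine ⟨S, R, V, E, ?_, ?_, ?_, ?_, ?_, ?_⟩
  · intro p q
    rcases hcases p q with rfl | ⟨l, hl⟩ | ⟨hne, h0⟩
    · rw [hR1]; norm_num
    · rw [hRl _ _ _ hl]; exact hlv0 l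
    · rw [h0]
  · intro p q
    refine ⟨fun h => ?_, fun h => by rw [h, hR1]⟩
    rcases hcases p q with h' | ⟨l, hl⟩ | ⟨hne, h0⟩
    · exact h'
    · rw [hRl _ _ _ hl] at h; have := hlv1 l; linarith
    · rw [h0] at h; norm_num at h
  · intro p q
    rcases hcases p q with rfl | ⟨l, hl⟩ | ⟨hne, h0⟩
    · rw [hR1]
    · rw [hRl _ _ _ hl]; exact (hlv1 l).le
    · rw [h0]; norm_num
  · intro p q
    by_cases h : ∃ l, Lk p.1 q.1 l
    · obtain ⟨l, hl⟩ := h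
      rw [hRl _ _ _ hl, hRl _ _ _ ((hLks _ _ _).1 hl)]
    · by_cases hpq : p = q
      · rw [hpq]
      · rw [hR0 _ _ hpq h, hR0 _ _ (Ne.symm hpq)]
        rintro ⟨l, hl⟩
        exact h ⟨l, (hLks _ _ _).1 hl⟩
  · intro p i l hl
    obtain ⟨h1, h2⟩ := sAt_of_lAt _ _ _ _ hl
    rw [hRl _ _ l]
    · exact (hlv l l.d ⟨l.α, l.memJ⟩).2 (by cases l.d <;> simp [pleq])
    · rw [hE _ h1, hE _ h2]
      exact Or.inl ⟨i, 0, rfl, by rw [hf0]; exact hl⟩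
  · intro p Γ Δ hs
    have hp := hE p ⟨_, hs⟩
    refine ⟨fun A hA => (truth A (E p)).1 ?_, fun A hA => (truth A (E p)).2 ?_⟩
    · rw [hp]; exact ⟨0, Γ, Δ, by rw [hf0]; exact hs, hA⟩
    · rw [hp]; exact ⟨0, Γ, Δ, by rw [hf0]; exact hs, hA⟩

/-- Cut-elimination for NSMB: every nested-sequent provable
in NSMB has a proof that does not use the rule (cut). -/
theorem cut_elimination_NSMB {Pm : MBParams} (t : NSeq Pm)
    (h : Provable true t) : Provable false t := by
  by_contra hu
  obtain ⟨S, R, V, E, h0, h1, hle, hs, he, hf⟩ := complete t hu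
  exact sound h0 h1 hle hs h E he hf

end MBQL
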